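/- Let R be a principal ideal domain. Let C• = {d_{q+1}: C_{q+1} → C_q}_{q≥0} and C'• = {d'_{q+1}: C'_{q+1} → C'_q}_{q≥0} be nonnegatively graded chain complexes of R-modules such that, for every q ≥ 0, C_q and C'_q are finitely generated free R-modules of the same rank, and the homology modules H_q(C•) and H_q(C'•) are isomorphic as R-modules. Then C• and C'• are isomorphic as R-chain complexes, i.e., there exist R-module isomorphisms f_q : C_q → C'_q with d'_q ∘ f_q = f_{q-1} ∘ d_q for all q. -/

import Mathlib

/-!
STATEMENT 0: Over a PID `R`, two nonnegatively graded chain complexes of finitely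
generated free `R`-modules with (degreewise) equal ranks and isomorphic homology
modules are isomorphic as chain complexes of `R`-modules.

A chain complex is given by modules `C q` (`q ≥ 0`) and differentials
`d q : C (q+1) →ₗ[R] C q` with `d ∘ d = 0`.  Its `q`-th homology is
`ker(d : C q → C (q-1)) / im(d : C (q+1) → C q)` (with `ker` interpreted as all of
`C 0` in degree `0`).
-/

section ChainComplexDefs

variable {R : Type*} [Ring R] {C : ℕ → Type*}
  [∀ q, AddCommGroup (C q)] [∀ q, Module R (C q)]

/-- The cycle submodule `Z_q` of a nonnegatively graded chain complex:
`Z_0 = C_0` and `Z_{q+1} = ker (d_q : C_{q+1} → C_q)`. -/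
def cyclesOf (d : ∀ q, C (q + 1) →ₗ[R] C q) : ∀ q, Submodule R (C q)
  | 0 => ⊤
  | q + 1 => LinearMap.ker (d q)

/-- The `q`-th homology of a nonnegatively graded chain complex:
cycles modulo boundaries. -/
abbrev homologyOf (d : ∀ q, C (q + 1) →ₗ[R] C q) (q : ℕ) : Type _ :=
  cyclesOf d q ⧸
    Submodule.comap (cyclesOf d q).subtype (LinearMap.range (d q))

end ChainComplexDefs

/-- A functional `φ` whose image of `N` is maximal among all functionals takes a value on `N`
dividing every value taken on `N` by every functional, and splits the corresponding line off. -/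
theorem exists_functional_dvd {R F : Type*} [CommRing R] [IsDomain R] [IsPrincipalIdealRing R]
    [AddCommGroup F] [Module R F] [Module.Free R F] [Module.Finite R F]
    (N : Submodule R F) (hN : N ≠ ⊥) :
    ∃ (φ : F →ₗ[R] R) (y : F) (a : R), φ y = 1 ∧ a • y ∈ N ∧
      ∀ (ψ : F →ₗ[R] R), ∀ x ∈ N, a ∣ ψ x := by
  obtain ⟨φ, hφ⟩ : ∃ φ : F →ₗ[R] R, ∀ ψ : F →ₗ[R] R,
      N.map φ ≤ N.map ψ → N.map ψ ≤ N.map φ := by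
    obtain ⟨_, ⟨φ, rfl⟩, h⟩ := (wellFounded_gt (α := Ideal R)).has_min
      (Set.range fun φ : F →ₗ[R] R ↦ (N.map φ : Ideal R)) ⟨_, 0, rfl⟩
    refine ⟨φ, fun ψ hle ↦ ?_⟩
    by_contra hlt
    exact h _ ⟨ψ, rfl⟩ (lt_of_le_not_ge hle hlt)
  obtain ⟨a, ha⟩ := IsPrincipalIdealRing.principal (N.map φ : Ideal R)
  have ha' : ∀ x ∈ N, a ∣ φ x := fun x hx ↦ by
    rw [← Ideal.mem_span_singleton, ← Ideal.submodule_span_eq, ← ha]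
    exact Submodule.mem_map_of_mem hx
  obtain ⟨y, hyN, hya⟩ : a ∈ N.map φ := ha ▸ Submodule.mem_span_singleton_self a
  have key : ∀ ψ : F →ₗ[R] R, ∀ z ∈ N, ψ z ∣ a → ∀ x ∈ N, a ∣ ψ x := by
    intro ψ z hz hza x hx
    have h1 : N.map φ ≤ N.map ψ := by
      rw [ha, Submodule.span_singleton_le_iff_mem]
      obtain ⟨c, rfl⟩ := hza
      exact ⟨c • z, N.smul_mem c hz, by simp [mul_comm]⟩
    have h2 := hφ ψ h1 (Submodule.mem_map_of_mem hx)
    rw [ha] at h2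
    exact Ideal.mem_span_singleton.mp h2
  have hψy : ∀ ψ : F →ₗ[R] R, a ∣ ψ y := by
    intro ψ
    obtain ⟨g, hg⟩ := IsPrincipalIdealRing.principal (Ideal.span {a, ψ y})
    rw [Ideal.submodule_span_eq] at hg
    have hga : g ∣ a := Ideal.mem_span_singleton.mp (hg ▸ Ideal.subset_span (by simp))
    have hgy : g ∣ ψ y := Ideal.mem_span_singleton.mp (hg ▸ Ideal.subset_span (by simp))
    obtain ⟨u, v, huv⟩ := Ideal.mem_span_pair.mp
      (show g ∈ Ideal.span {a, ψ y} from hg ▸ Ideal.mem_span_singleton_self g)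
    have hval : (u • φ + v • ψ) y = g := by simp [hya, huv]
    exact (hval ▸ key (u • φ + v • ψ) y hyN (hval ▸ hga) y hyN).trans hgy
  let B := Module.Free.chooseBasis R F
  have ha0 : a ≠ 0 := by
    rintro rfl
    obtain ⟨x, hx, hx0⟩ := Submodule.exists_mem_ne_zero_of_ne_bot hN
    refine hx0 (B.ext_elem fun i ↦ ?_)
    have h := key (B.coord i) y hyN (by simp) x hx
    simpa using h
  choose t ht using fun i ↦ hψy (B.coord i)
  have hy : y = a • ∑ i, t i • B i := by
    rw [Finset.smul_sum]
    conv_lhs => rw [← B.sum_repr y]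
    refine Finset.sum_congr rfl fun i _ ↦ ?_
    rw [smul_smul, ← ht, B.coord_apply]
  have hφ1 : φ (∑ i, t i • B i) = 1 := by
    apply mul_left_cancel₀ ha0
    rw [mul_one, ← smul_eq_mul, ← map_smul, ← hy, hya]
  refine ⟨φ, _, a, hφ1, hy ▸ hyN, fun ψ x hx ↦ ?_⟩
  obtain ⟨s, hs⟩ := hψy ψ
  have h := key (φ + (ψ - ψ (∑ i, t i • B i) • φ)) y hyN (by
    have : ψ y = ψ (∑ i, t i • B i) * a := by
      conv_lhs => rw [hy]
      rw [map_smul, smul_eq_mul, mul_comm]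
    simp [hya, this]) x hx
  have h2 := ha' x hx
  have : ψ x = (φ + (ψ - ψ (∑ i, t i • B i) • φ)) x - φ x + ψ (∑ i, t i • B i) * φ x := by
    simp only [LinearMap.add_apply, LinearMap.sub_apply, LinearMap.smul_apply, smul_eq_mul]
    ring
  rw [this]
  exact dvd_add (dvd_sub h h2) (h2.mul_left _)

/-- A functional taking the value `1` at `y` splits off the line spanned by `y`. -/
def LinearMap.equivProdKer {R F : Type*} [CommRing R] [AddCommGroup F] [Module R F]
    (φ : F →ₗ[R] R) (y : F) (hy : φ y = 1) : F ≃ₗ[R] R × LinearMap.ker φ where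
  toFun x := (φ x, ⟨x - φ x • y, by simp [hy]⟩)
  invFun p := p.1 • y + p.2
  map_add' x z := by ext <;> simp; module
  map_smul' c x := by ext <;> simp; module
  left_inv x := by simp
  right_inv p := by
    have h : φ p.2 = 0 := p.2.2
    ext <;> simp [hy, h]

/-- **Smith normal form** for submodules, with the divisibility chain. -/
theorem exists_smithNormalForm_dvd {R : Type*} [CommRing R] [IsDomain R] [IsPrincipalIdealRing R]
    (n : ℕ) {F : Type*} [AddCommGroup F] [Module R F] [Module.Free R F] [Module.Finite R F]
    (hn : Module.finrank R F = n) (N : Submodule R F) :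
    ∃ (e : F ≃ₗ[R] (Fin n → R)) (a : Fin n → R), (∀ i j, i ≤ j → a i ∣ a j) ∧
      ∀ x, x ∈ N ↔ ∀ i, a i ∣ e x i := by
  induction n generalizing F with
  | zero =>
    have := (Module.finrank_eq_zero_iff_of_free (R := R) (M := F)).mp hn
    exact ⟨LinearEquiv.ofSubsingleton _ _, 0, fun i ↦ i.elim0, fun x ↦
      ⟨fun _ i ↦ i.elim0, fun _ ↦ Subsingleton.elim (0 : F) x ▸ N.zero_mem⟩⟩
  | succ n ih =>
    by_cases hN : N = ⊥
    · subst hN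
      let e := (Module.finBasisOfFinrankEq R F hn).equivFun
      refine ⟨e, 0, fun _ _ _ ↦ dvd_rfl, fun x ↦ ?_⟩
      rw [Submodule.mem_bot, ← e.map_eq_zero_iff, funext_iff]
      simp
    obtain ⟨φ, y, a, hy, hyN, hdvd⟩ := exists_functional_dvd N hN
    let s := φ.equivProdKer y hy
    have hK : Module.finrank R (LinearMap.ker φ) = n := by
      have h := s.finrank_eq
      rw [hn, Module.finrank_prod, Module.finrank_self] at h
      omega
    obtain ⟨e, b, hb, he⟩ := ih hK (N.comap (LinearMap.ker φ).subtype)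
    refine ⟨s ≪≫ₗ (LinearEquiv.refl R R).prodCongr e ≪≫ₗ Fin.consLinearEquiv R (fun _ ↦ R),
      Fin.cons a b, ?_, fun x ↦ ?_⟩
    · have hab : ∀ i, a ∣ b i := by
        intro i
        have hmem : e.symm (Pi.single i (b i)) ∈ N.comap (LinearMap.ker φ).subtype := by
          rw [he]
          intro j
          rw [e.apply_symm_apply]
          by_cases hj : j = i
          · subst hj; simp
          · simp [hj]
        have h := hdvd (LinearMap.proj i ∘ₗ e.toLinearMap ∘ₗ LinearMap.snd R R _ ∘ₗ s.toLinearMap)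
          _ hmem
        have hs : s (e.symm (Pi.single i (b i)) : LinearMap.ker φ) =
            (0, e.symm (Pi.single i (b i))) := by
          rw [← LinearEquiv.eq_symm_apply]
          simp [s, LinearMap.equivProdKer]
        simpa [hs] using h
      intro i j hij
      induction i using Fin.cases with
      | zero =>
        induction j using Fin.cases with
        | zero => exact dvd_rfl
        | succ j => simpa using hab j
      | succ i =>
        induction j using Fin.cases with
        | zero => simp at hij
        | succ j => simpa using hb i j (by simpa using hij)
    · have h1 : x ∈ N ↔ a ∣ φ x ∧ x - φ x • y ∈ N := by
        have h2 : a ∣ φ x → φ x • y ∈ N := by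
          rintro ⟨c, hc⟩
          rw [hc, mul_comm, mul_smul]
          exact N.smul_mem c hyN
        exact ⟨fun hx ↦ ⟨hdvd φ x hx, N.sub_mem hx (h2 (hdvd φ x hx))⟩,
          fun ⟨h, h'⟩ ↦ by simpa using N.add_mem h' (h2 h)⟩
      have h3 := he (s x).2
      rw [Fin.forall_fin_succ, h1]
      exact and_congr Iff.rfl h3

/-- The `i`-th invariant factor `a i` of `N ≤ F` divides `c` if and only if `c • (F ⧸ N)` is
generated by as many elements as there are indices above `i`. -/
theorem smithNormalForm_dvd_iff {R F : Type*} [CommRing R] [AddCommGroup F] [Module R F]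
    {n : ℕ} (N : Submodule R F) (e : F ≃ₗ[R] (Fin n → R)) (a : Fin n → R)
    (ha : ∀ i j, i ≤ j → a i ∣ a j) (hN : ∀ x, x ∈ N ↔ ∀ i, a i ∣ e x i) (i : Fin n) (c : R) :
    a i ∣ c ↔ ∃ w : {j // i < j} → F ⧸ N, ∀ m, ∃ r : {j // i < j} → R,
      c • m = c • ∑ j, r j • w j := by
  constructor
  · intro hc
    refine ⟨fun j ↦ N.mkQ (e.symm (Pi.single j.1 1)), fun m ↦ ?_⟩
    obtain ⟨x, rfl⟩ := N.mkQ_surjective m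
    refine ⟨fun j ↦ e x j, ?_⟩
    simp only [← map_smul, ← map_sum]
    rw [← sub_eq_zero, ← map_sub, Submodule.mkQ_apply, Submodule.Quotient.mk_eq_zero, hN]
    intro k
    by_cases hk : i < k
    · have : (∑ j : {j // i < j}, e x j * (Pi.single j.1 (1 : R) : Fin n → R) k) = e x k := by
        rw [Finset.sum_eq_single ⟨k, hk⟩]
        · simp
        · rintro j - hj
          rw [Pi.single_eq_of_ne, mul_zero]
          exact fun h ↦ hj (Subtype.ext h.symm)
        · simp
      simp [this]
    · rw [map_sub, e.apply_symm_apply, map_smul, ← smul_sub]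
      exact ((ha k i (not_lt.mp hk)).trans hc).mul_right _
  · rintro ⟨w, hw⟩
    by_contra hc
    let I : Ideal R := Submodule.comap (LinearMap.mulLeft R c) (Ideal.span {a i})
    have hI : ∀ t, t ∈ I ↔ a i ∣ c * t := fun t ↦ Ideal.mem_span_singleton
    have : Nontrivial (R ⧸ I) := Ideal.Quotient.nontrivial_iff.mpr fun h ↦ hc <| by
      simpa using (hI 1).mp (h ▸ Submodule.mem_top)
    choose v hv using fun j ↦ N.mkQ_surjective (w j)
    let g : ({j // i < j} → R ⧸ I) →ₗ[R ⧸ I] ({j // i ≤ j} → R ⧸ I) :=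
      Fintype.linearCombination (R ⧸ I) fun j k ↦ Ideal.Quotient.mk I (e (v j) k)
    have hg : Function.Surjective g := by
      intro t
      choose u hu using fun k ↦ Ideal.Quotient.mk_surjective (t k)
      obtain ⟨r, hr⟩ := hw (N.mkQ (e.symm fun k ↦ if h : i ≤ k then u ⟨k, h⟩ else 0))
      simp only [← hv, ← map_smul, ← map_sum] at hr
      rw [← sub_eq_zero, ← map_sub, Submodule.mkQ_apply, Submodule.Quotient.mk_eq_zero, hN] at hr
      refine ⟨fun j ↦ Ideal.Quotient.mk I (r j), ?_⟩
      ext k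
      have h := (ha i k k.2).trans (hr k)
      rw [map_sub, e.apply_symm_apply, map_smul, ← smul_sub, Pi.smul_apply, smul_eq_mul, ← hI,
        Pi.sub_apply, ← Ideal.Quotient.eq] at h
      simp only [k.2, dif_pos, hu] at h
      rw [h]
      simp [g, Fintype.linearCombination_apply]
    have hcard := card_le_of_surjective (R ⧸ I) g hg
    refine absurd hcard (not_le.mpr ?_)
    exact Fintype.card_lt_of_injective_of_notMem (fun j ↦ ⟨j.1, j.2.le⟩)
      (fun j k h ↦ Subtype.ext (congrArg (fun t : {j // i ≤ j} ↦ t.1) h)) (b := ⟨i, le_rfl⟩)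
      (by rintro ⟨j, hj⟩; exact j.2.ne' (congrArg (fun t : {j // i ≤ j} ↦ t.1) hj))

/-- Submodules of finite free modules of equal rank over a principal ideal domain are equivalent
as soon as the quotients are isomorphic. -/
theorem exists_linearEquiv_mem_iff_of_quotient_equiv {R F F' : Type*} [CommRing R] [IsDomain R]
    [IsPrincipalIdealRing R] [AddCommGroup F] [Module R F] [Module.Free R F] [Module.Finite R F]
    [AddCommGroup F'] [Module R F'] [Module.Free R F'] [Module.Finite R F']
    (hF : Module.finrank R F = Module.finrank R F') (N : Submodule R F) (N' : Submodule R F')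
    (h : (F ⧸ N) ≃ₗ[R] (F' ⧸ N')) :
    ∃ f : F ≃ₗ[R] F', ∀ x, f x ∈ N' ↔ x ∈ N := by
  obtain ⟨e, a, ha, he⟩ := exists_smithNormalForm_dvd _ hF N
  obtain ⟨e', a', ha', he'⟩ := exists_smithNormalForm_dvd _ rfl N'
  refine ⟨e ≪≫ₗ e'.symm, fun x ↦ ?_⟩
  have key : ∀ i c, a i ∣ c ↔ a' i ∣ c := by
    intro i c
    rw [smithNormalForm_dvd_iff N e a ha he, smithNormalForm_dvd_iff N' e' a' ha' he']
    constructor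
    · rintro ⟨w, hw⟩
      refine ⟨fun j ↦ h (w j), fun m ↦ ?_⟩
      obtain ⟨r, hr⟩ := hw (h.symm m)
      exact ⟨r, by simpa using congrArg h hr⟩
    · rintro ⟨w, hw⟩
      refine ⟨fun j ↦ h.symm (w j), fun m ↦ ?_⟩
      obtain ⟨r, hr⟩ := hw (h m)
      exact ⟨r, by simpa using congrArg h.symm hr⟩
  rw [he, he']
  simp [key]

/-- Isomorphisms of the kernels and of the ranges of two linear maps are induced by an
isomorphism of the sources, if the ranges are projective. -/
theorem exists_linearEquiv_extending_ker_range {R A B A' B' : Type*} [CommRing R]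
    [AddCommGroup A] [Module R A] [AddCommGroup B] [Module R B]
    [AddCommGroup A'] [Module R A'] [AddCommGroup B'] [Module R B']
    (d : A →ₗ[R] B) (d' : A' →ₗ[R] B')
    [Module.Projective R (LinearMap.range d)] [Module.Projective R (LinearMap.range d')]
    (z : LinearMap.ker d ≃ₗ[R] LinearMap.ker d') (b : LinearMap.range d ≃ₗ[R] LinearMap.range d') :
    ∃ f : A ≃ₗ[R] A', (∀ x : LinearMap.ker d, f x = z x) ∧
      ∀ x, d' (f x) = b ⟨d x, LinearMap.mem_range_self d x⟩ := by
  obtain ⟨s, hs⟩ := d.rangeRestrict.exists_rightInverse_of_surjective d.range_rangeRestrict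
  obtain ⟨s', hs'⟩ := d'.rangeRestrict.exists_rightInverse_of_surjective d'.range_rangeRestrict
  have hs : ∀ y, d (s y) = y := fun y ↦ congrArg Subtype.val (LinearMap.congr_fun hs y)
  have hs' : ∀ y, d' (s' y) = y := fun y ↦ congrArg Subtype.val (LinearMap.congr_fun hs' y)
  let p : A →ₗ[R] LinearMap.ker d :=
    (LinearMap.id - s ∘ₗ d.rangeRestrict).codRestrict _ fun x ↦ by simp [hs]
  let p' : A' →ₗ[R] LinearMap.ker d' :=
    (LinearMap.id - s' ∘ₗ d'.rangeRestrict).codRestrict _ fun x ↦ by simp [hs']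
  let f : A →ₗ[R] A' := (LinearMap.ker d').subtype ∘ₗ z.toLinearMap ∘ₗ p +
    s' ∘ₗ b.toLinearMap ∘ₗ d.rangeRestrict
  let g : A' →ₗ[R] A := (LinearMap.ker d).subtype ∘ₗ z.symm.toLinearMap ∘ₗ p' +
    s ∘ₗ b.symm.toLinearMap ∘ₗ d'.rangeRestrict
  have hdf : ∀ x, d'.rangeRestrict (f x) = b (d.rangeRestrict x) := fun x ↦ by
    ext; simp [f, hs']
  have hdg : ∀ x, d.rangeRestrict (g x) = b.symm (d'.rangeRestrict x) := fun x ↦ by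
    ext; simp [g, hs]
  have hpf : ∀ x, p' (f x) = z (p x) := fun x ↦ by
    ext
    change f x - s' (d'.rangeRestrict (f x)) = _
    rw [hdf]; simp [f]
  have hpg : ∀ x, p (g x) = z.symm (p' x) := fun x ↦ by
    ext
    change g x - s (d.rangeRestrict (g x)) = _
    rw [hdg]; simp [g]
  refine ⟨LinearEquiv.ofLinearMap f g ?_ ?_, fun x ↦ ?_, fun x ↦ congrArg Subtype.val (hdf x)⟩
  · ext x
    change (z (p (g x)) : A') + s' (b (d.rangeRestrict (g x))) = x
    rw [hpg, hdg]; simp [p']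
  · ext x
    change (z.symm (p' (f x)) : A) + s (b.symm (d'.rangeRestrict (f x))) = x
    rw [hpf, hdf]; simp [p]
  · have h : d.rangeRestrict x = 0 := Subtype.ext x.2
    have hp : p x = x := by
      ext
      change (x : A) - s (d.rangeRestrict x) = x
      rw [h]; simp
    change (z (p x) : A') + s' (b (d.rangeRestrict x)) = z x
    rw [h, hp]; simp

theorem range_le_cyclesOf {R : Type*} [Ring R] {C : ℕ → Type*}
    [∀ q, AddCommGroup (C q)] [∀ q, Module R (C q)] (d : ∀ q, C (q + 1) →ₗ[R] C q)
    (hdd : ∀ q, (d q).comp (d (q + 1)) = 0) (q : ℕ) : LinearMap.range (d q) ≤ cyclesOf d q := by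
  cases q with
  | zero => exact le_top
  | succ q => exact LinearMap.range_le_ker_iff.mpr (hdd q)

theorem finrank_homologyOf_add_finrank_range {R : Type*} [CommRing R] [IsDomain R] {C : ℕ → Type*}
    [∀ q, AddCommGroup (C q)] [∀ q, Module R (C q)] (d : ∀ q, C (q + 1) →ₗ[R] C q)
    (hdd : ∀ q, (d q).comp (d (q + 1)) = 0) [IsNoetherianRing R] [∀ q, Module.Finite R (C q)]
    (q : ℕ) :
    Module.finrank R (homologyOf d q) + Module.finrank R (LinearMap.range (d q)) =
      Module.finrank R (cyclesOf d q) := by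
  rw [← (Submodule.comapSubtypeEquivOfLe (range_le_cyclesOf d hdd q)).finrank_eq]
  exact Submodule.finrank_quotient_add_finrank _

theorem finrank_cyclesOf_eq {R : Type*} [CommRing R] [IsDomain R] [IsNoetherianRing R]
    {C C' : ℕ → Type*}
    [∀ q, AddCommGroup (C q)] [∀ q, Module R (C q)] [∀ q, AddCommGroup (C' q)]
    [∀ q, Module R (C' q)] (d : ∀ q, C (q + 1) →ₗ[R] C q) (d' : ∀ q, C' (q + 1) →ₗ[R] C' q)
    (hdd : ∀ q, (d q).comp (d (q + 1)) = 0) (hdd' : ∀ q, (d' q).comp (d' (q + 1)) = 0)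
    [∀ q, Module.Finite R (C q)] [∀ q, Module.Finite R (C' q)]
    (hrank : ∀ q, Module.finrank R (C q) = Module.finrank R (C' q))
    (hhomology : ∀ q, Module.finrank R (homologyOf d q) = Module.finrank R (homologyOf d' q))
    (q : ℕ) : Module.finrank R (cyclesOf d q) = Module.finrank R (cyclesOf d' q) := by
  induction q with
  | zero =>
    change Module.finrank R (⊤ : Submodule R (C 0)) = Module.finrank R (⊤ : Submodule R (C' 0))
    rw [finrank_top, finrank_top, hrank]
  | succ q ih =>
    have h1 := finrank_homologyOf_add_finrank_range d hdd q
    have h2 := finrank_homologyOf_add_finrank_range d' hdd' q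
    have h3 := (LinearMap.ker (d q)).finrank_quotient_add_finrank
    have h4 := (LinearMap.ker (d' q)).finrank_quotient_add_finrank
    rw [(d q).quotKerEquivRange.finrank_eq] at h3
    rw [(d' q).quotKerEquivRange.finrank_eq] at h4
    have h5 := hrank (q + 1)
    have h6 := hhomology q
    change Module.finrank R (LinearMap.ker (d q)) = Module.finrank R (LinearMap.ker (d' q))
    omega

theorem chainComplex_iso_of_free_same_rank_iso_homology
    (R : Type*) [CommRing R] [IsDomain R] [IsPrincipalIdealRing R]
    (C C' : ℕ → Type*)
    [∀ q, AddCommGroup (C q)] [∀ q, Module R (C q)]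
    [∀ q, AddCommGroup (C' q)] [∀ q, Module R (C' q)]
    (d : ∀ q, C (q + 1) →ₗ[R] C q) (d' : ∀ q, C' (q + 1) →ₗ[R] C' q)
    (hdd : ∀ q, (d q).comp (d (q + 1)) = 0)
    (hdd' : ∀ q, (d' q).comp (d' (q + 1)) = 0)
    [∀ q, Module.Free R (C q)] [∀ q, Module.Finite R (C q)]
    [∀ q, Module.Free R (C' q)] [∀ q, Module.Finite R (C' q)]
    (hrank : ∀ q, Module.finrank R (C q) = Module.finrank R (C' q))
    (hhomology : ∀ q, Nonempty (homologyOf d q ≃ₗ[R] homologyOf d' q)) :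
    ∃ f : ∀ q, C q ≃ₗ[R] C' q,
      ∀ q, (d' q).comp (f (q + 1) : C (q + 1) →ₗ[R] C' (q + 1)) =
        LinearMap.comp (f q : C q →ₗ[R] C' q) (d q) := by
  have hz : ∀ q, ∃ z : cyclesOf d q ≃ₗ[R] cyclesOf d' q,
      ∀ x, (z x : C' q) ∈ LinearMap.range (d' q) ↔ (x : C q) ∈ LinearMap.range (d q) := fun q ↦
    exists_linearEquiv_mem_iff_of_quotient_equiv
      (finrank_cyclesOf_eq d d' hdd hdd' hrank (fun q ↦ (hhomology q).some.finrank_eq) q)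
      _ _ (hhomology q).some
  choose z hz using hz
  have hb : ∀ q, ∃ b : LinearMap.range (d q) ≃ₗ[R] LinearMap.range (d' q),
      ∀ x, (b x : C' q) = z q ⟨x, range_le_cyclesOf d hdd q x.2⟩ := by
    intro q
    have hmap : (((LinearMap.range (d q)).comap (cyclesOf d q).subtype).map (z q).toLinearMap) =
        (LinearMap.range (d' q)).comap (cyclesOf d' q).subtype := by
      ext x
      rw [Submodule.mem_map_equiv]
      simpa using (hz q ((z q).symm x)).symm
    exact ⟨(Submodule.comapSubtypeEquivOfLe (range_le_cyclesOf d hdd q)).symm ≪≫ₗ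
      (z q).ofSubmodules _ _ hmap ≪≫ₗ
      Submodule.comapSubtypeEquivOfLe (range_le_cyclesOf d' hdd' q), fun x ↦ rfl⟩
  choose b hb using hb
  have hf : ∀ q, ∃ f : C (q + 1) ≃ₗ[R] C' (q + 1),
      (∀ x : cyclesOf d (q + 1), f x = z (q + 1) x) ∧
        ∀ x, d' q (f x) = b q ⟨d q x, LinearMap.mem_range_self (d q) x⟩ := fun q ↦
    exists_linearEquiv_extending_ker_range (d q) (d' q) (z (q + 1)) (b q)
  choose f hfz hfd using hf
  let f₀ : C 0 ≃ₗ[R] C' 0 :=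
    Submodule.topEquiv.symm ≪≫ₗ (z 0 : (⊤ : Submodule R (C 0)) ≃ₗ[R] (⊤ : Submodule R (C' 0))) ≪≫ₗ
      Submodule.topEquiv
  refine ⟨fun q ↦ Nat.casesOn q f₀ f, fun q ↦ LinearMap.ext fun x ↦ ?_⟩
  refine (hfd q x).trans ((hb q _).trans ?_)
  cases q with
  | zero => rfl
  | succ q => exact (hfz q _).symm
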